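/- Let C be a permutation-invariant partition of the player set of a finite normal-form game with identical interests. Then every internally chain transitive set of the centroid CT-ECFP differential inclusion ẏ ∈ BR(y) − y (on the set of centroid, i.e. class-constant, distributions) is contained in the set SNE of symmetric Nash equilibria. -/

import Mathlib

open MeasureTheory Filter Topology

noncomputable section

namespace ECFP

variable {ι A κ : Type*}

/-- The mixed-strategy simplex over a finite action set `Y` inside the action universe `A`. -/
def simplex (Y : Finset A) : Set (A → ℝ) :=
  {p | (∀ a, 0 ≤ p a) ∧ (∀ a, a ∉ Y → p a = 0) ∧ ∑ a ∈ Y, p a = 1}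

/-- The space `Δⁿ` of joint mixed strategies. -/
def Delta (Y : ι → Finset A) : Set (ι → A → ℝ) :=
  {p | ∀ i, p i ∈ simplex (Y i)}

variable [Fintype ι] [DecidableEq ι] [Fintype A] [DecidableEq κ]

/-- The mixed extension of the common utility `u`:
`U(p₁,…,pₙ) = ∑_y u(y) p₁(y₁)⋯pₙ(yₙ)`. -/
def U (u : (ι → A) → ℝ) (p : ι → A → ℝ) : ℝ :=
  ∑ y : ι → A, u y * ∏ i, p i (y i)

/-- The `ε`-best-response set of player `i` against the joint strategy `p`
(only the components `p_{-i}` matter, since player `i`'s component is overwritten):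
`{pᵢ ∈ Δᵢ : U(pᵢ,p_{-i}) ≥ U(qᵢ,p_{-i}) - ε  ∀ qᵢ ∈ Δᵢ}`. -/
def BRi (Y : ι → Finset A) (u : (ι → A) → ℝ) (ε : ℝ) (p : ι → A → ℝ) (i : ι) :
    Set (A → ℝ) :=
  {pi | pi ∈ simplex (Y i) ∧
    ∀ qi ∈ simplex (Y i),
      U u (Function.update p i pi) ≥ U u (Function.update p i qi) - ε}

/-- The joint `ε`-best-response set `BR^ε(p) = (BR₁^ε(p_{-1}),…,BRₙ^ε(p_{-n}))`. -/
def BR (Y : ι → Finset A) (u : (ι → A) → ℝ) (ε : ℝ) (p : ι → A → ℝ) :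
    Set (ι → A → ℝ) :=
  {b | ∀ i, b i ∈ BRi Y u ε p i}

/-- The profile obtained from `y` by swapping the strategies of players `i` and `j`. -/
def swapStrat (y : ι → A) (i j : ι) : ι → A :=
  Function.update (Function.update y i (y j)) j (y i)

/-- `cls : ι → κ` encodes a permutation-invariant partition of the player set (the classes
are the fibers of `cls`): players in the same class have the same action set, and the utility
is invariant under swapping the strategies of two same-class players in any strategy profile. -/
def PermInvariant (Y : ι → Finset A) (u : (ι → A) → ℝ) (cls : ι → κ) : Prop :=
  ∀ i j : ι, cls i = cls j →
    Y i = Y j ∧ ∀ y : ι → A, (∀ k, y k ∈ Y k) → u (swapStrat y i j) = u y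

/-- The equivalence class (as a finset of players) of player `i`. -/
def cluster (cls : ι → κ) (i : ι) : Finset ι :=
  Finset.univ.filter (fun j => cls j = cls i)

/-- The centroid distribution `p̄`: player `i` is assigned the average of the strategies of
the players in `i`'s class. -/
def centroid (cls : ι → κ) (p : ι → A → ℝ) : ι → A → ℝ :=
  fun i => ((cluster cls i).card : ℝ)⁻¹ • ∑ j ∈ cluster cls i, p j

/-- A joint strategy is class-constant if same-class players use identical strategies. -/
def classConst (cls : ι → κ) (p : ι → A → ℝ) : Prop :=
  ∀ i j, cls i = cls j → p i = p j

/-- The set of Nash equilibria. -/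
def NE (Y : ι → Finset A) (u : (ι → A) → ℝ) : Set (ι → A → ℝ) :=
  {p | p ∈ Delta Y ∧ ∀ i, ∀ qi ∈ simplex (Y i),
    U u (Function.update p i qi) ≤ U u p}

/-- The set of symmetric Nash equilibria relative to the partition `cls`. -/
def SNE (Y : ι → Finset A) (u : (ι → A) → ℝ) (cls : ι → κ) : Set (ι → A → ℝ) :=
  {p | p ∈ NE Y u ∧ classConst cls p}

/-- The set of mean-centric equilibria relative to the partition `cls`:
`U(pᵢ, p̄_{-i}) ≥ U(pᵢ', p̄_{-i})` for all `pᵢ' ∈ Δᵢ` and all `i`. -/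
def MCE (Y : ι → Finset A) (u : (ι → A) → ℝ) (cls : ι → κ) : Set (ι → A → ℝ) :=
  {p | p ∈ Delta Y ∧ ∀ i, ∀ qi ∈ simplex (Y i),
    U u (Function.update (centroid cls p) i qi)
      ≤ U u (Function.update (centroid cls p) i (p i))}

/-- `V(p) = (1/n) ∑ᵢ U(pᵢ, p̄_{-i})`. -/
def Vfun (u : (ι → A) → ℝ) (cls : ι → κ) (p : ι → A → ℝ) : ℝ :=
  (Fintype.card ι : ℝ)⁻¹ * ∑ i, U u (Function.update (centroid cls p) i (p i))

/-- A discrete-time ECFP process w.r.t. `(Γ, 𝒞)`: `q(1) = a(1)`,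
`q(t+1) = q(t) + γₜ (a(t+1) − q(t))` and `a(t+1) ∈ BR^{εₜ}(q̄(t))` for all `t`
(time is indexed by `ℕ`, i.e. `t = 0` plays the role of `t = 1` in the paper). -/
structure IsECFP (Y : ι → Finset A) (u : (ι → A) → ℝ) (cls : ι → κ)
    (γ ε : ℕ → ℝ) (a q : ℕ → ι → A → ℝ) : Prop where
  a_init_mem : a 0 ∈ Delta Y
  q_mem : ∀ t, q t ∈ Delta Y
  init : q 0 = a 0
  step : ∀ t, q (t + 1) = q t + γ t • (a (t + 1) - q t)
  br : ∀ t, a (t + 1) ∈ BR Y u (ε t) (centroid cls (q t))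

/-- A solution of the differential inclusion `ẋ ∈ F(x)` taking values in `Δⁿ`:
an everywhere-`Δⁿ`-valued trajectory on `[0,∞)` which is the integral of a locally
integrable selection `g(t) ∈ F(x(t))` (a.e.). -/
def IsSolution (Y : ι → Finset A) (F : (ι → A → ℝ) → Set (ι → A → ℝ))
    (x : ℝ → ι → A → ℝ) : Prop :=
  (∀ t : ℝ, 0 ≤ t → x t ∈ Delta Y) ∧
  ∃ g : ℝ → ι → A → ℝ,
    LocallyIntegrableOn g (Set.Ici (0 : ℝ)) ∧
    (∀ᵐ t ∂(volume.restrict (Set.Ici (0 : ℝ))), g t ∈ F (x t)) ∧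
    ∀ t : ℝ, 0 ≤ t → x t = x 0 + ∫ s in Set.Ioc (0 : ℝ) t, g s

/-- Right-hand side of the joint CT-ECFP differential inclusion `q̇ ∈ BR(q̄) − q`. -/
def Fjoint (Y : ι → Finset A) (u : (ι → A) → ℝ) (cls : ι → κ)
    (q : ι → A → ℝ) : Set (ι → A → ℝ) :=
  (fun b => b - q) '' BR Y u 0 (centroid cls q)

/-- Right-hand side of the centroid CT-ECFP differential inclusion `ẏ ∈ BR(y) − y`. -/
def Fcent (Y : ι → Finset A) (u : (ι → A) → ℝ)
    (y : ι → A → ℝ) : Set (ι → A → ℝ) :=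
  (fun b => b - y) '' BR Y u 0 y

/-- The ω-limit set of a continuous-time trajectory: all limits of sequences
`x(t_k)` with `t_k → ∞`. -/
def omegaLimitSet (x : ℝ → ι → A → ℝ) : Set (ι → A → ℝ) :=
  {p | ∃ tk : ℕ → ℝ, Tendsto tk atTop atTop ∧ Tendsto (fun k => x (tk k)) atTop (𝓝 p)}

/-- The set of limit points of a (discrete-time) sequence. -/
def seqLimitPoints (q : ℕ → ι → A → ℝ) : Set (ι → A → ℝ) :=
  {p | ∃ φ : ℕ → ℕ, StrictMono φ ∧ Tendsto (fun k => q (φ k)) atTop (𝓝 p)}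

/-- A compact set `X ⊆ Δⁿ` is internally chain transitive for the inclusion `ẋ ∈ F(x)`:
any two points of `X` can be joined, for every `ε > 0` and `T > 0`, by finitely many
solution pieces of duration `> T` staying in `X`, with jumps of size `≤ ε`. -/
def InternallyChainTransitive (Y : ι → Finset A)
    (F : (ι → A → ℝ) → Set (ι → A → ℝ)) (X : Set (ι → A → ℝ)) : Prop :=
  IsCompact X ∧ X ⊆ Delta Y ∧
  ∀ ξ ∈ X, ∀ η ∈ X, ∀ ε : ℝ, 0 < ε → ∀ T : ℝ, 0 < T →
    ∃ k : ℕ, 0 < k ∧ ∃ x : ℕ → ℝ → ι → A → ℝ, ∃ tt : ℕ → ℝ,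
      (∀ i < k, IsSolution Y F (x i)) ∧
      (∀ i < k, T < tt i) ∧
      (∀ i < k, ∀ s : ℝ, 0 ≤ s → s ≤ tt i → x i s ∈ X) ∧
      (∀ i, i + 1 < k → ‖x i (tt i) - x (i + 1) 0‖ ≤ ε) ∧
      ‖x 0 0 - ξ‖ ≤ ε ∧ ‖x (k - 1) (tt (k - 1)) - η‖ ≤ ε

end ECFP


open scoped IntermediateField.algebraAdjoinAdjoin TensorProduct in
/-- In characteristic zero, an element with vanishing Kähler differential is algebraic. -/
theorem isAlgebraic_of_kaehlerDifferential_D_eq_zero {K L : Type*} [Field K] [CharZero K]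
    [Field L] [Algebra K L] [Algebra.EssFiniteType K L] {f : L}
    (hf : KaehlerDifferential.D K L f = 0) : IsAlgebraic K f := by
  by_contra halg
  have hv : AlgebraicIndependent K (fun _ : Unit => f) :=
    algebraicIndependent_unique_type_iff.mpr halg
  let S := Algebra.adjoin K (Set.range fun _ : Unit => f)
  let E := IntermediateField.adjoin K (Set.range fun _ : Unit => f)
  have : Algebra.FormallySmooth S E := .of_isLocalization (nonZeroDivisors _)
  have : Algebra.EssFiniteType E L := .of_comp K E L
  have : CharZero E := charZero_of_injective_algebraMap (algebraMap K E).injective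
  have : Algebra.FormallySmooth E L := inferInstance
  have : Algebra.FormallySmooth S L := .comp S E L
  have hinj : Function.Injective (KaehlerDifferential.mapBaseChange K S L) := by
    rw [injective_iff_map_eq_zero]
    intro x hx
    obtain ⟨y, rfl⟩ := (Algebra.H1Cotangent.exact_δ_mapBaseChange K S L x).mp hx
    rw [Subsingleton.elim y 0, map_zero]
  let e : MvPolynomial Unit K ≃ₐ[K] S := hv.aevalEquiv
  let s : S := e (MvPolynomial.X ())
  have hs : algebraMap S L s = f := (hv.algebraMap_aevalEquiv _).trans (MvPolynomial.aeval_X _ _)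
  have hzero : (1 : L) ⊗ₜ[S] KaehlerDifferential.D K S s = 0 := by
    apply hinj
    rw [map_zero, KaehlerDifferential.mapBaseChange_tmul, one_smul, KaehlerDifferential.map_D, hs, hf]
  let d : Derivation K S L := Derivation.mk'
    ((Algebra.linearMap S L).restrictScalars K ∘ₗ e.toLinearMap ∘ₗ
      (MvPolynomial.pderiv (R := K) ()).toLinearMap ∘ₗ e.symm.toLinearMap) (by
        intro a b
        simp [Algebra.smul_def, Derivation.leibniz])
  have h1 : d s = 1 := by simp [d, s]
  have h2 : d.liftKaehlerDifferential.liftBaseChange L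
      ((1 : L) ⊗ₜ[S] KaehlerDifferential.D K S s) = 1 := by simp [h1]
  rw [hzero, map_zero] at h2
  exact zero_ne_one h2

theorem Derivation.map_finset_prod {R S M κ : Type*} [CommSemiring R] [CommSemiring S]
    [AddCommMonoid M] [Algebra R S] [Module S M] [Module R M] [DecidableEq κ]
    (D : Derivation R S M) (s : Finset κ) (z : κ → S) :
    D (∏ i ∈ s, z i) = ∑ i ∈ s, (∏ j ∈ s.erase i, z j) • D (z i) := by
  induction s using Finset.induction_on with
  | empty => simp
  | insert k s hk ih =>
    rw [Finset.prod_insert hk, D.leibniz, ih, Finset.sum_insert hk, Finset.erase_insert hk,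
      add_comm, Finset.smul_sum]
    congr 1
    refine Finset.sum_congr rfl fun i hi => ?_
    have hki : k ≠ i := fun h => hk (h ▸ hi)
    rw [Finset.erase_insert_of_ne hki, Finset.prod_insert (fun h => hk (Finset.mem_of_mem_erase h)),
      mul_smul]

/-- If the differential of `f` vanishes on every irreducible component of the zero locus of `I`,
then `f` takes only finitely many values on the rational points of this locus. -/
theorem exists_polynomial_isRoot_of_kaehlerDifferential_D_eq_zero {K R : Type*} [Field K]
    [CharZero K] [CommRing R] [Algebra K R] [Algebra.FiniteType K R] (I : Ideal R) (f : R)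
    (hD : ∀ P : Ideal R, ∀ _ : P.IsPrime, I ≤ P →
      KaehlerDifferential.D K (FractionRing (R ⧸ P)) (algebraMap (R ⧸ P) _ (Ideal.Quotient.mk P f)) = 0) :
    ∃ p : Polynomial K, p ≠ 0 ∧
      ∀ ψ : R →ₐ[K] K, (∀ x ∈ I, ψ x = 0) → p.IsRoot (ψ f) := by
  have : IsNoetherianRing R := Algebra.FiniteType.isNoetherianRing K R
  have hfin := I.finite_minimalPrimes_of_isNoetherianRing
  have key : ∀ P : Ideal R, ∃ p : Polynomial K, p ≠ 0 ∧
      (P ∈ I.minimalPrimes → Polynomial.aeval f p ∈ P) := by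
    intro P
    by_cases hP : P ∈ I.minimalPrimes
    · have hPp : P.IsPrime := hP.1.1
      obtain ⟨p, hp0, hp⟩ := isAlgebraic_of_kaehlerDifferential_D_eq_zero (hD P hPp hP.1.2)
      refine ⟨p, hp0, fun _ => ?_⟩
      rw [Polynomial.aeval_algebraMap_apply, map_eq_zero_iff _
        (IsFractionRing.injective (R ⧸ P) (FractionRing (R ⧸ P)))] at hp
      rw [← Ideal.Quotient.eq_zero_iff_mem, ← hp]
      exact (Polynomial.aeval_algHom_apply (Ideal.Quotient.mkₐ K P) f p).symm
    · exact ⟨1, one_ne_zero, fun h => absurd h hP⟩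
  choose p hp0 hp using key
  refine ⟨∏ P ∈ hfin.toFinset, p P, Finset.prod_ne_zero_iff.mpr fun P _ => hp0 P, ?_⟩
  intro ψ hψ
  have hker : (RingHom.ker ψ).IsPrime := RingHom.ker_isPrime ψ
  obtain ⟨P, hP, hPle⟩ := Ideal.exists_minimalPrimes_le (I := I) (J := RingHom.ker ψ)
    (fun x hx => hψ x hx)
  rw [Polynomial.IsRoot.def, Polynomial.eval_prod]
  refine Finset.prod_eq_zero (hfin.mem_toFinset.mpr hP) ?_
  have := hPle (hp P hP)
  rw [RingHom.mem_ker, ← Polynomial.aeval_algHom_apply] at this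
  simpa using this

namespace ECFP

/-- The multilinear extension of `u`, evaluated in an arbitrary commutative `ℝ`-algebra. -/
def multilinearExt {ι A B : Type*} [Fintype ι] [DecidableEq ι] [Fintype A] [CommRing B]
    [Algebra ℝ B] (u : (ι → A) → ℝ) (z : ι → A → B) : B :=
  ∑ y : ι → A, algebraMap ℝ B (u y) * ∏ i, z i (y i)

theorem prod_update_apply {ι A B : Type*} [Fintype ι] [DecidableEq ι] [CommRing B] (z : ι → A → B) (i : ι) (q : A → B) (y : ι → A) :
    ∏ j, Function.update z i q j (y j) = q (y i) * ∏ j ∈ Finset.univ.erase i, z j (y j) := by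
  rw [← Finset.mul_prod_erase _ _ (Finset.mem_univ i), Function.update_self]
  congr 1
  refine Finset.prod_congr rfl fun j hj => ?_
  rw [Function.update_of_ne (Finset.ne_of_mem_erase hj)]

section

variable {ι A B : Type*} [Fintype ι] [DecidableEq ι] [Fintype A] [CommRing B] [Algebra ℝ B]

theorem multilinearExt_update [DecidableEq A] (u : (ι → A) → ℝ) (z : ι → A → B) (i : ι)
    (q : A → B) :
    multilinearExt u (Function.update z i q) =
      ∑ a, q a * multilinearExt u (Function.update z i (Pi.single a 1)) := by
  simp only [multilinearExt, prod_update_apply, Finset.mul_sum]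
  rw [Finset.sum_comm]
  refine Finset.sum_congr rfl fun y _ => ?_
  rw [Finset.sum_eq_single (y i)]
  · simp only [Pi.single_eq_same]
    ring
  · intro a _ ha
    simp [Pi.single_eq_of_ne ha.symm]
  · simp

theorem map_multilinearExt {C : Type*} [CommRing C] [Algebra ℝ C] (φ : B →ₐ[ℝ] C)
    (u : (ι → A) → ℝ) (z : ι → A → B) :
    φ (multilinearExt u z) = multilinearExt u fun i a => φ (z i a) := by
  simp [multilinearExt]

theorem map_multilinearExt_update_single [DecidableEq A] {C : Type*} [CommRing C] [Algebra ℝ C]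
    (φ : B →ₐ[ℝ] C) (u : (ι → A) → ℝ) (z : ι → A → B) (i : ι) (a : A) :
    φ (multilinearExt u (Function.update z i (Pi.single a 1))) =
      multilinearExt u (Function.update (fun i a => φ (z i a)) i (Pi.single a 1)) := by
  rw [map_multilinearExt]
  congr 1
  ext j b
  rcases eq_or_ne j i with rfl | hj
  · simp [Pi.single_apply, apply_ite φ]
  · simp [hj]

theorem derivation_multilinearExt [DecidableEq A] {M : Type*} [AddCommGroup M] [Module B M]
    [Module ℝ M] (D : Derivation ℝ B M) (u : (ι → A) → ℝ) (z : ι → A → B) :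
    D (multilinearExt u z) =
      ∑ i, ∑ a, multilinearExt u (Function.update z i (Pi.single a 1)) • D (z i a) := by
  simp only [multilinearExt, prod_update_apply, map_sum, D.leibniz, D.map_algebraMap, smul_zero,
    add_zero, D.map_finset_prod, Finset.sum_smul, Finset.smul_sum]
  rw [Finset.sum_comm]
  refine Finset.sum_congr rfl fun i _ => ?_
  rw [Finset.sum_comm]
  refine Finset.sum_congr rfl fun y _ => ?_
  rw [Finset.sum_eq_single (y i)]
  · simp [mul_smul]
  · intro a _ ha
    simp [Pi.single_eq_of_ne ha.symm]
  · simp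

/-- A derivation kills the common payoff at a profile with unit total masses satisfying
complementary slackness. -/
theorem derivation_multilinearExt_eq_zero [DecidableEq A] [IsDomain B] {M : Type*}
    [AddCommGroup M] [Module B M] [Module ℝ M] (D : Derivation ℝ B M) (u : (ι → A) → ℝ)
    (z : ι → A → B) (hsum : ∀ i, ∑ a, z i a = 1)
    (hslack : ∀ i a, z i a *
      (multilinearExt u (Function.update z i (Pi.single a 1)) - multilinearExt u z) = 0) :
    D (multilinearExt u z) = 0 := by
  have hterm : ∀ i a, multilinearExt u (Function.update z i (Pi.single a 1)) • D (z i a) =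
      multilinearExt u z • D (z i a) := by
    intro i a
    rcases mul_eq_zero.mp (hslack i a) with h | h
    · simp [h]
    · rw [sub_eq_zero.mp h]
  rw [derivation_multilinearExt]
  simp only [hterm, ← Finset.smul_sum, ← map_sum, hsum, D.map_one_eq_zero, smul_zero,
    Finset.sum_const_zero]

end

section

variable {ι A : Type*} [Fintype ι] [DecidableEq ι] [Fintype A]

/-- The payoff takes finitely many values on the profiles with unit total masses satisfying
complementary slackness. -/
theorem finite_multilinearExt_image_slack [DecidableEq A] (u : (ι → A) → ℝ) :
    (multilinearExt u '' {z : ι → A → ℝ | (∀ i, ∑ a, z i a = 1) ∧ ∀ i a, z i a *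
      (multilinearExt u (Function.update z i (Pi.single a 1)) - multilinearExt u z) = 0}).Finite := by
  let R := MvPolynomial (ι × A) ℝ
  let X : ι → A → R := fun i a => MvPolynomial.X (i, a)
  let slack : ι × A → R := fun x => X x.1 x.2 *
    (multilinearExt u (Function.update X x.1 (Pi.single x.2 1)) - multilinearExt u X)
  let I : Ideal R := Ideal.span (Set.range (fun i => ∑ a, X i a - 1) ∪ Set.range slack)
  obtain ⟨p, hp0, hp⟩ := exists_polynomial_isRoot_of_kaehlerDifferential_D_eq_zero (K := ℝ)
    I (multilinearExt u X) (by
      intro P hP hIP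
      let φ : R →ₐ[ℝ] FractionRing (R ⧸ P) :=
        (IsScalarTower.toAlgHom ℝ (R ⧸ P) _).comp (Ideal.Quotient.mkₐ ℝ P)
      have hφ : ∀ x ∈ I, φ x = 0 := by
        intro x hx
        have : Ideal.Quotient.mk P x = 0 := Ideal.Quotient.eq_zero_iff_mem.mpr (hIP hx)
        simp [φ, this]
      change KaehlerDifferential.D ℝ _ (φ (multilinearExt u X)) = 0
      rw [map_multilinearExt]
      apply derivation_multilinearExt_eq_zero
      · intro i
        have := hφ _ (Ideal.subset_span (Or.inl ⟨i, rfl⟩))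
        rw [map_sub, map_sum, map_one, sub_eq_zero] at this
        exact this
      · intro i a
        have := hφ _ (Ideal.subset_span (Or.inr ⟨(i, a), rfl⟩))
        rw [map_mul, map_sub, map_multilinearExt_update_single, map_multilinearExt] at this
        exact this)
  refine (p.roots.toFinset.finite_toSet).subset ?_
  rintro _ ⟨z, ⟨hsum, hslack⟩, rfl⟩
  let ψ : R →ₐ[ℝ] ℝ := MvPolynomial.aeval fun x => z x.1 x.2
  have hψX : (fun i a => ψ (X i a)) = z := by
    ext i a
    exact MvPolynomial.aeval_X _ _
  have hroot := hp ψ (by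
    intro x hx
    rw [← RingHom.mem_ker]
    refine (Ideal.span_le (I := RingHom.ker ψ)).mpr ?_ hx
    rintro _ (⟨i, rfl⟩ | ⟨⟨i, a⟩, rfl⟩)
    · simp only [SetLike.mem_coe, RingHom.mem_ker, map_sub, map_sum, map_one]
      rw [← hsum i, ← hψX, sub_self]
    · rw [SetLike.mem_coe, RingHom.mem_ker, map_mul, map_sub,
        map_multilinearExt_update_single, map_multilinearExt, hψX,
        ← hslack i a, ← congr_fun (congr_fun hψX i) a])
  rw [map_multilinearExt, hψX] at hroot
  simpa [hp0] using hroot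

end

section

variable {ι A : Type*}

theorem sum_eq_one_of_mem_simplex [Fintype A] {S : Finset A} {p : A → ℝ} (hp : p ∈ simplex S) :
    ∑ a, p a = 1 := by
  rw [← hp.2.2]
  exact (Finset.sum_subset (Finset.subset_univ S) fun a _ ha => hp.2.1 a ha).symm

theorem single_mem_simplex [DecidableEq A] {S : Finset A} {a : A} (ha : a ∈ S) :
    Pi.single a 1 ∈ simplex S := by
  refine ⟨fun b => ?_, fun b hb => ?_, ?_⟩
  · exact (Pi.single_nonneg.mpr zero_le_one : (0 : A → ℝ) ≤ Pi.single a (1 : ℝ)) b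
  · exact Pi.single_eq_of_ne (ne_of_mem_of_not_mem ha hb).symm _
  · simp [ha]

theorem isClosed_simplex (S : Finset A) : IsClosed (simplex S) := by
  have : simplex S = (⋂ a, {p : A → ℝ | 0 ≤ p a}) ∩ (⋂ a, ⋂ _ : a ∉ S, {p : A → ℝ | p a = 0}) ∩
      {p | ∑ a ∈ S, p a = 1} := by
    ext p
    simp [simplex, and_assoc]
  rw [this]
  refine ((isClosed_iInter fun a => ?_).inter (isClosed_iInter fun a => isClosed_iInter fun _ => ?_)).inter ?_
  · exact isClosed_le continuous_const (continuous_apply a)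
  · exact isClosed_eq (continuous_apply a) continuous_const
  · exact isClosed_eq (by fun_prop) continuous_const

theorem isClosed_Delta (Y : ι → Finset A) : IsClosed (Delta Y) := by
  have : Delta Y = ⋂ i, (fun p : ι → A → ℝ => p i) ⁻¹' simplex (Y i) := by
    ext p
    simp [Delta]
  rw [this]
  exact isClosed_iInter fun i => (isClosed_simplex (Y i)).preimage (continuous_apply i)

variable [Fintype ι] [Fintype A]

theorem norm_le_one_of_mem_Delta {Y : ι → Finset A} {p : ι → A → ℝ} (hp : p ∈ Delta Y) :
    ‖p‖ ≤ 1 := by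
  refine (pi_norm_le_iff_of_nonneg zero_le_one).mpr fun i =>
    (pi_norm_le_iff_of_nonneg zero_le_one).mpr fun a => ?_
  rw [Real.norm_of_nonneg ((hp i).1 a), ← sum_eq_one_of_mem_simplex (hp i)]
  exact Finset.single_le_sum (fun b _ => (hp i).1 b) (Finset.mem_univ a)

theorem isCompact_Delta (Y : ι → Finset A) : IsCompact (Delta Y) :=
  (isCompact_closedBall (0 : ι → A → ℝ) 1).of_isClosed_subset (isClosed_Delta Y)
    fun _ hp => mem_closedBall_zero_iff.mpr (norm_le_one_of_mem_Delta hp)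

variable [DecidableEq ι]

theorem contDiff_U (u : (ι → A) → ℝ) : ContDiff ℝ 1 (U u) := by
  unfold U
  fun_prop

theorem U_update_single_sum [DecidableEq A] (u : (ι → A) → ℝ) (p : ι → A → ℝ) (i : ι)
    (q : A → ℝ) :
    U u (Function.update p i q) = ∑ a, q a * U u (Function.update p i (Pi.single a 1)) :=
  multilinearExt_update u p i q

theorem U_update_sub (u : (ι → A) → ℝ) (p : ι → A → ℝ) (i : ι) (b c : A → ℝ) :
    U u (Function.update p i (b - c)) =
      U u (Function.update p i b) - U u (Function.update p i c) := by
  simp only [U, prod_update_apply, Pi.sub_apply, sub_mul, mul_sub, Finset.sum_sub_distrib]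

theorem hasDerivAt_U_comp (u : (ι → A) → ℝ) {x : ℝ → ι → A → ℝ} {x' : ι → A → ℝ} {t : ℝ}
    (hx : HasDerivAt x x' t) :
    HasDerivAt (fun s => U u (x s)) (∑ i, U u (Function.update (x t) i (x' i))) t := by
  have hx' : ∀ i a, HasDerivAt (fun s => x s i a) (x' i a) t := fun i a =>
    hasDerivAt_pi.mp (hasDerivAt_pi.mp hx i) a
  simp only [U]
  rw [Finset.sum_comm]
  refine HasDerivAt.fun_sum fun y _ => ?_
  rw [← Finset.mul_sum]
  refine (HasDerivAt.fun_finsetProd fun i _ => hx' i (y i)).const_mul (u y) |>.congr_deriv ?_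
  congr 1
  refine Finset.sum_congr rfl fun i _ => ?_
  rw [prod_update_apply, smul_eq_mul, mul_comm]

/-- The total gain available through unilateral best responses. -/
def deviationGain (Y : ι → Finset A) (hY : ∀ i, (Y i).Nonempty) (u : (ι → A) → ℝ)
    (p : ι → A → ℝ) : ℝ :=
  open scoped Classical in
  ∑ i, ((Y i).sup' (hY i) (fun a => U u (Function.update p i (Pi.single a 1))) - U u p)

variable {Y : ι → Finset A} (hY : ∀ i, (Y i).Nonempty) (u : (ι → A) → ℝ)

theorem continuous_deviationGain : Continuous (deviationGain Y hY u) := by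
  have hU := (contDiff_U u).continuous
  refine continuous_finsetSum _ fun i _ => Continuous.sub ?_ hU
  refine Continuous.finset_sup'_apply (hY i) fun a _ => hU.comp ?_
  exact continuous_id.update i continuous_const

theorem U_update_le_sup' [DecidableEq A] (p : ι → A → ℝ) (i : ι) {q : A → ℝ}
    (hq : q ∈ simplex (Y i)) :
    U u (Function.update p i q) ≤
      (Y i).sup' (hY i) (fun a => U u (Function.update p i (Pi.single a 1))) := by
  set m := (Y i).sup' (hY i) (fun a => U u (Function.update p i (Pi.single a 1)))
  have hm : m = ∑ a, q a * m := by
    rw [← Finset.sum_mul, sum_eq_one_of_mem_simplex hq, one_mul]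
  rw [U_update_single_sum, hm]
  refine Finset.sum_le_sum fun a _ => ?_
  by_cases ha : a ∈ Y i
  · exact mul_le_mul_of_nonneg_left
      (Finset.le_sup' (fun a => U u (Function.update p i (Pi.single a 1))) ha) (hq.1 a)
  · simp [hq.2.1 a ha]

theorem deviationGain_nonneg {p : ι → A → ℝ} (hp : p ∈ Delta Y) : 0 ≤ deviationGain Y hY u p := by
  classical
  refine Finset.sum_nonneg fun i _ => sub_nonneg.mpr ?_
  have := U_update_le_sup' hY u p i (hp i)
  rw [Function.update_eq_self] at this
  convert this

theorem mem_NE_of_deviationGain_eq_zero {p : ι → A → ℝ} (hp : p ∈ Delta Y)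
    (h : deviationGain Y hY u p = 0) : p ∈ NE Y u := by
  classical
  refine ⟨hp, fun i q hq => ?_⟩
  have hnonneg : ∀ j ∈ Finset.univ, 0 ≤ (Y j).sup' (hY j)
      (fun a => U u (Function.update p j (Pi.single a 1))) - U u p := by
    intro j _
    have := U_update_le_sup' hY u p j (hp j)
    rw [Function.update_eq_self] at this
    exact sub_nonneg.mpr this
  have hi := (Finset.sum_eq_zero_iff_of_nonneg hnonneg).mp (by
    rw [← h, deviationGain]) i (Finset.mem_univ i)
  exact (U_update_le_sup' hY u p i hq).trans (sub_eq_zero.mp hi).le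

theorem deviationGain_le_of_mem_BR {p b : ι → A → ℝ} (hb : b ∈ BR Y u 0 p) :
    deviationGain Y hY u p ≤ ∑ i, U u (Function.update p i ((b - p) i)) := by
  classical
  refine Finset.sum_le_sum fun i _ => ?_
  rw [Pi.sub_apply, U_update_sub, Function.update_eq_self]
  refine sub_le_sub_right (Finset.sup'_le _ _ fun a ha => ?_) _
  have := (hb i).2 _ (single_mem_simplex ha)
  rw [sub_zero] at this
  convert this

theorem finite_U_image_NE (Y : ι → Finset A) (u : (ι → A) → ℝ) : (U u '' NE Y u).Finite := by
  classical
  refine (finite_multilinearExt_image_slack u).subset (Set.image_mono ?_)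
  rintro p ⟨hp, hne⟩
  refine ⟨fun i => sum_eq_one_of_mem_simplex (hp i), fun i => ?_⟩
  have hle : ∀ a ∈ Finset.univ,
      p i a * (U u (Function.update p i (Pi.single a 1)) - U u p) ≤ 0 := by
    intro a _
    by_cases ha : a ∈ Y i
    · exact mul_nonpos_of_nonneg_of_nonpos ((hp i).1 a)
        (sub_nonpos.mpr (hne i _ (single_mem_simplex ha)))
    · simp [(hp i).2.1 a ha]
  have hsum : ∑ a, p i a * (U u (Function.update p i (Pi.single a 1)) - U u p) = 0 := by
    simp only [mul_sub, Finset.sum_sub_distrib, ← Finset.sum_mul]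
    rw [← U_update_single_sum, Function.update_eq_self, sum_eq_one_of_mem_simplex (hp i)]
    ring
  exact fun a => (Finset.sum_eq_zero_iff_of_nonpos hle).mp hsum a (Finset.mem_univ a)

end

section

variable {ι A : Type*} [Fintype ι] [DecidableEq ι] [Fintype A] {Y : ι → Finset A}
  {u : (ι → A) → ℝ} {x : ℝ → ι → A → ℝ}

theorem IsSolution.lipschitzOnWith (hx : IsSolution Y (Fcent Y u) x) :
    LipschitzOnWith 2 x (Set.Ici 0) ∧
      ∀ᵐ t, 0 < t → ∃ b ∈ BR Y u 0 (x t), HasDerivAt x (b - x t) t := by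
  obtain ⟨hmem, g, hg, hgF, hgint⟩ := hx
  have hgF' : ∀ᵐ t, 0 ≤ t → g t ∈ Fcent Y u (x t) :=
    (ae_restrict_iff' measurableSet_Ici).mp hgF
  have hii : ∀ a b : ℝ, 0 ≤ a → 0 ≤ b → IntervalIntegrable g volume a b := fun a b ha hb =>
    ((hg.integrableOn_compact_subset (Set.uIcc_subset_Icc
      ⟨ha, le_max_left a b⟩ ⟨hb, le_max_right a b⟩ |>.trans Set.Icc_subset_Ici_self)
      isCompact_uIcc).intervalIntegrable)
  have hx_eq : ∀ t, 0 ≤ t → x t = x 0 + ∫ s in (0 : ℝ)..t, g s := fun t ht => by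
    rw [hgint t ht, intervalIntegral.integral_of_le ht]
  refine ⟨LipschitzOnWith.of_dist_le_mul fun t ht s hs => ?_, ?_⟩
  · rw [dist_eq_norm, hx_eq t ht, hx_eq s hs, add_sub_add_left_eq_sub,
      intervalIntegral.integral_interval_sub_left (hii 0 t le_rfl ht) (hii 0 s le_rfl hs),
      Real.dist_eq]
    refine intervalIntegral.norm_integral_le_of_norm_le_const_ae ?_
    filter_upwards [hgF'] with r hr hrst
    have hr0 : 0 ≤ r := (le_min hs ht).trans hrst.1.le
    obtain ⟨b, hb, hbg⟩ := hr hr0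
    rw [← hbg]
    calc ‖b - x r‖ ≤ ‖b‖ + ‖x r‖ := norm_sub_le _ _
      _ ≤ 1 + 1 := add_le_add (norm_le_one_of_mem_Delta (Y := Y) fun i => (hb i).1)
        (norm_le_one_of_mem_Delta (hmem r hr0))
      _ = _ := by norm_num
  · have hderiv : ∀ᵐ t, ∀ n : ℕ, t ∈ Set.uIcc (0 : ℝ) n → ∀ c ∈ Set.uIcc (0 : ℝ) n,
        HasDerivAt (fun t => ∫ s in c..t, g s) (g t) t :=
      ae_all_iff.mpr fun n => (hii 0 n le_rfl n.cast_nonneg).ae_hasDerivAt_integral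
    filter_upwards [hgF', hderiv] with t ht hdt ht0
    obtain ⟨b, hb, hbg⟩ := ht ht0.le
    obtain ⟨n, hn⟩ := exists_nat_ge t
    refine ⟨b, hb, ?_⟩
    have := (hdt n (Set.mem_uIcc.mpr (Or.inl ⟨ht0.le, hn⟩)) 0 Set.left_mem_uIcc).const_add (x 0)
    rw [← hbg] at this
    refine this.congr_of_eventuallyEq ?_
    filter_upwards [lt_mem_nhds ht0] with s hs
    exact hx_eq s hs.le

theorem IsSolution.continuousOn (hx : IsSolution Y (Fcent Y u) x) :
    ContinuousOn x (Set.Ici 0) :=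
  hx.lipschitzOnWith.1.continuousOn

/-- Along a solution, the common payoff grows at least as fast as the deviation gain. -/
theorem IsSolution.mul_sub_le_U_sub (hx : IsSolution Y (Fcent Y u) x)
    (hY : ∀ i, (Y i).Nonempty) {s t c : ℝ} (hs : 0 ≤ s) (hst : s ≤ t)
    (hc : ∀ r ∈ Set.Icc s t, c ≤ deviationGain Y hY u (x r)) :
    c * (t - s) ≤ U u (x t) - U u (x s) := by
  obtain ⟨hlip, hderiv⟩ := hx.lipschitzOnWith
  obtain ⟨K, hK⟩ := (contDiff_U u).contDiffOn.exists_lipschitzOnWith one_ne_zero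
    (convex_closedBall (0 : ι → A → ℝ) 1) (isCompact_closedBall _ _)
  have hIcc : Set.uIcc s t ⊆ Set.Ici 0 := by
    rw [Set.uIcc_of_le hst]
    exact fun r hr => hs.trans hr.1
  have hac : AbsolutelyContinuousOnInterval (fun r => U u (x r)) s t :=
    (hK.comp (hlip.mono hIcc) fun r hr => mem_closedBall_zero_iff.mpr
      (norm_le_one_of_mem_Delta (hx.1 r (hIcc hr)))).absolutelyContinuousOnInterval
  rw [← hac.integral_deriv_eq_sub]
  calc c * (t - s) = ∫ _ in s..t, c := by simp [mul_comm]
    _ ≤ _ := by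
      refine intervalIntegral.integral_mono_ae_restrict hst intervalIntegrable_const
        hac.intervalIntegrable_deriv ?_
      rw [← restrict_Ioo_eq_restrict_Icc]
      refine (ae_restrict_iff' measurableSet_Ioo).mpr ?_
      filter_upwards [hderiv] with r hr hrst
      obtain ⟨b, hb, hbr⟩ := hr (hs.trans_lt hrst.1)
      rw [(hasDerivAt_U_comp u hbr).deriv]
      exact (hc r (Set.Ioo_subset_Icc_self hrst)).trans (deviationGain_le_of_mem_BR hY u hb)

theorem IsSolution.monotoneOn_U (hx : IsSolution Y (Fcent Y u) x) (hY : ∀ i, (Y i).Nonempty) :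
    MonotoneOn (fun t => U u (x t)) (Set.Ici 0) := by
  intro s hs t _ hst
  have := hx.mul_sub_le_U_sub hY hs hst
    fun r hr => deviationGain_nonneg hY u (hx.1 r (hs.trans hr.1))
  simpa using this

/-- A solution starting slightly below a level that is not an equilibrium payoff
climbs above that level in unit time. -/
theorem exists_pos_forall_add_le_U (hY : ∀ i, (Y i).Nonempty) {v : ℝ} (hv : v ∉ U u '' NE Y u) :
    ∃ δ > 0, ∀ x, IsSolution Y (Fcent Y u) x → v - δ ≤ U u (x 0) →
      ∀ t, 1 < t → v + δ ≤ U u (x t) := by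
  obtain ⟨r, hr, hball⟩ := Metric.isOpen_iff.mp
    (finite_U_image_NE Y u).isClosed.isOpen_compl v hv
  let B := Delta Y ∩ {p | |U u p - v| ≤ r / 2}
  have hB : IsCompact B := (isCompact_Delta Y).inter_right
    (isClosed_le ((contDiff_U u).continuous.sub continuous_const).abs continuous_const)
  have hpos : ∀ p ∈ B, 0 < deviationGain Y hY u p := by
    rintro p ⟨hp, hpv⟩
    refine (deviationGain_nonneg hY u hp).lt_of_ne' fun h => ?_
    refine hball (a := U u p) ?_ ⟨p, mem_NE_of_deviationGain_eq_zero hY u hp h, rfl⟩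
    rw [Metric.mem_ball, Real.dist_eq]
    exact lt_of_le_of_lt hpv (half_lt_self hr)
  obtain ⟨c, hc0, hc⟩ : ∃ c > 0, ∀ p ∈ B, c ≤ deviationGain Y hY u p :=
    hB.exists_forall_le' (continuous_deviationGain hY u).continuousOn hpos
  refine ⟨min r c / 2, by positivity, fun x hx h0 t ht => ?_⟩
  by_contra! hlt
  have hmono := hx.monotoneOn_U hY
  have ht0 : 0 ≤ t := by linarith
  have hmem : ∀ s ∈ Set.Icc 0 t, x s ∈ B := by
    intro s hs
    refine ⟨hx.1 s hs.1, show |U u (x s) - v| ≤ r / 2 from abs_le.mpr ?_⟩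
    have h1 : U u (x 0) ≤ U u (x s) := hmono Set.self_mem_Ici hs.1 hs.1
    have h2 : U u (x s) ≤ U u (x t) := hmono hs.1 ht0 hs.2
    have h3 := min_le_left r c
    constructor <;> linarith
  have := hx.mul_sub_le_U_sub hY le_rfl ht0 fun s hs => hc _ (hmem s hs)
  have h3 := min_le_right r c
  nlinarith

theorem InternallyChainTransitive.U_mem {X : Set (ι → A → ℝ)}
    (hX : InternallyChainTransitive Y (Fcent Y u) X) (hY : ∀ i, (Y i).Nonempty)
    {p : ι → A → ℝ} (hp : p ∈ X) : U u p ∈ U u '' NE Y u := by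
  by_contra hv
  obtain ⟨δ, hδ, hclimb⟩ := exists_pos_forall_add_le_U hY hv
  obtain ⟨-, hXD, hchain⟩ := hX
  obtain ⟨ε, hε, huc⟩ := Metric.uniformContinuousOn_iff_le.mp
    ((isCompact_Delta Y).uniformContinuousOn_of_continuous (contDiff_U u).continuous.continuousOn)
    (δ / 2) (by positivity)
  obtain ⟨k, hk, x, t, hsol, ht, hmem, hjump, hstart, hend⟩ :=
    hchain p hp p hp ε hε 1 one_pos
  have htD : ∀ i < k, x i (t i) ∈ Delta Y := fun i hi =>
    (hsol i hi).1 _ (zero_le_one.trans (ht i hi).le)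
  have h0D : ∀ i < k, x i 0 ∈ Delta Y := fun i hi => (hsol i hi).1 0 le_rfl
  have hstep : ∀ i < k, U u p + δ ≤ U u (x i (t i)) := by
    intro i
    induction i with
    | zero =>
      intro hi
      refine hclimb _ (hsol 0 hi) ?_ _ (ht 0 hi)
      have := huc _ (h0D 0 hi) p (hXD hp) (by rwa [dist_eq_norm])
      rw [Real.dist_eq, abs_le] at this
      linarith
    | succ i ih =>
      intro hi
      have hi' : i < k := by omega
      refine hclimb _ (hsol _ hi) ?_ _ (ht _ hi)
      have := huc _ (htD i hi') _ (h0D _ hi) (by rw [dist_eq_norm]; exact hjump i hi)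
      rw [Real.dist_eq, abs_le] at this
      linarith [ih hi']
  have hlast : k - 1 < k := by omega
  have := huc _ (htD _ hlast) p (hXD hp) (by rwa [dist_eq_norm])
  rw [Real.dist_eq, abs_le] at this
  linarith [hstep _ hlast]

theorem IsSolution.deviationGain_eq_zero (hx : IsSolution Y (Fcent Y u) x)
    (hY : ∀ i, (Y i).Nonempty) {T : ℝ} (hT : 0 < T)
    (hval : ∀ t, 0 ≤ t → t ≤ T → U u (x t) ∈ U u '' NE Y u) :
    deviationGain Y hY u (x 0) = 0 := by
  by_contra hne
  have hpos : 0 < deviationGain Y hY u (x 0) :=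
    (deviationGain_nonneg hY u (hx.1 0 le_rfl)).lt_of_ne' hne
  have hcx : ContinuousWithinAt x (Set.Ici 0) 0 := hx.continuousOn 0 Set.self_mem_Ici
  have hgain : ∀ᶠ t in 𝓝[≥] (0 : ℝ),
      deviationGain Y hY u (x 0) / 2 < deviationGain Y hY u (x t) :=
    ((continuous_deviationGain hY u).continuousAt.comp_continuousWithinAt hcx).eventually
      (lt_mem_nhds (half_lt_self hpos))
  have hnhds : (U u '' NE Y u \ {U u (x 0)})ᶜ ∈ 𝓝 (U u (x 0)) :=
    ((finite_U_image_NE Y u).subset Set.sdiff_subset).isClosed.isOpen_compl.mem_nhds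
      fun h => h.2 rfl
  have hU : ∀ᶠ t in 𝓝[≥] (0 : ℝ), U u (x t) ∉ U u '' NE Y u \ {U u (x 0)} :=
    ((contDiff_U u).continuous.continuousAt.comp_continuousWithinAt hcx).eventually hnhds
  obtain ⟨s, hs, hsub⟩ := (mem_nhdsGE_iff_exists_Icc_subset).mp (hgain.and hU)
  have hs0 : (0 : ℝ) < s := hs
  have hmin : 0 < min s T := lt_min hs0 hT
  have hgrow := hx.mul_sub_le_U_sub hY le_rfl hmin.le
    fun r hr => (hsub ⟨hr.1, hr.2.trans (min_le_left s T)⟩).1.le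
  have heq : U u (x (min s T)) = U u (x 0) := by
    by_contra h
    exact (hsub ⟨hmin.le, min_le_left s T⟩).2
      ⟨hval _ hmin.le (min_le_right s T), h⟩
  nlinarith

theorem InternallyChainTransitive.subset_NE {X : Set (ι → A → ℝ)}
    (hX : InternallyChainTransitive Y (Fcent Y u) X) (hY : ∀ i, (Y i).Nonempty) :
    X ⊆ NE Y u := by
  intro p hp
  refine mem_NE_of_deviationGain_eq_zero hY u (hX.2.1 hp) ?_
  have hclosed : IsClosed {q | deviationGain Y hY u q = 0} :=
    isClosed_eq (continuous_deviationGain hY u) continuous_const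
  refine hclosed.closure_subset (Metric.mem_closure_iff.mpr fun ε hε => ?_)
  obtain ⟨k, hk, x, t, hsol, ht, hmem, -, hstart, -⟩ :=
    hX.2.2 p hp p hp (ε / 2) (half_pos hε) 1 one_pos
  refine ⟨x 0 0, (hsol 0 hk).deviationGain_eq_zero hY (zero_lt_one.trans (ht 0 hk))
    fun s hs hst => hX.U_mem hY (hmem 0 hk s hs hst), ?_⟩
  rw [dist_comm, dist_eq_norm]
  linarith

end

variable {ι A κ : Type*}

variable [Fintype ι] [DecidableEq ι] [Fintype A] [DecidableEq κ]

variable [Nonempty ι]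

/-- **Lemma 5(i).** Every internally chain transitive set of the centroid CT-ECFP inclusion
`ẏ ∈ BR(y) − y` (on the set of class-constant distributions) is contained in SNE. -/
theorem chain_transitive_subset_SNE
    (Y : ι → Finset A) (hY : ∀ i, (Y i).Nonempty) (u : (ι → A) → ℝ)
    (cls : ι → κ) (hpi : PermInvariant Y u cls)
    (X : Set (ι → A → ℝ))
    (hX : InternallyChainTransitive Y (Fcent Y u) X)
    (hXcc : ∀ p ∈ X, classConst cls p) :
    X ⊆ SNE Y u cls := by
  exact fun p hp => ⟨hX.subset_NE hY hp, hXcc p hp⟩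

end ECFP
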